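/- arXiv:2112.07619 — 3 statements merged into one kernel-verified Lean document; each statement's English description precedes it below -/
import Mathlib

section
/- Let φ = (1 + √5)/2 be the golden ratio and let λ = φ + √φ. Then λ^4 - 2λ^3 - 2λ^2 - 2λ + 1 = 0; that is, λ is a root of the polynomial p(x) = x^4 - 2x^3 - 2x^2 - 2x + 1. -/
theorem dilation_is_root :
    let φ : ℝ := (1 + Real.sqrt 5) / 2
    let lam : ℝ := φ + Real.sqrt φ
    lam ^ 4 - 2 * lam ^ 3 - 2 * lam ^ 2 - 2 * lam + 1 = 0 := by
  intro φ lam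
  have hφ : φ ^ 2 - φ - 1 = 0 := by
    have h5 : Real.sqrt 5 ^ 2 = 5 := Real.sq_sqrt (by norm_num)
    simp only [φ]
    linear_combination h5 / 4
  have hs : Real.sqrt φ ^ 2 = φ := Real.sq_sqrt (by positivity)
  have hlam : lam ^ 2 + 1 - 2 * φ * lam = 0 := by
    simp only [lam]
    linear_combination hs - hφ
  linear_combination (lam ^ 2 + 1 - 2 * (1 - φ) * lam) * hlam + 4 * lam ^ 2 * hφ
end

section
/- Let φ = (1 + √5)/2 be the golden ratio. The set of real roots of the polynomial p(x) = x^4 - 2x^3 - 2x^2 - 2x + 1 is exactly {φ - √φ, φ + √φ}; in particular, φ + √φ is the greatest real root of p. -/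
/-- If `φ ^ 2 = φ + 1` and `s ^ 2 = φ > 1`, then the real roots of
`x ^ 4 - 2 x ^ 3 - 2 x ^ 2 - 2 x + 1` are `φ - s` and `φ + s`. -/
theorem quartic_eq_zero_iff {φ s : ℝ} (hφ : φ ^ 2 = φ + 1) (hs : s ^ 2 = φ) (h1 : 1 < φ)
    (x : ℝ) :
    x ^ 4 - 2 * x ^ 3 - 2 * x ^ 2 - 2 * x + 1 = 0 ↔ x = φ - s ∨ x = φ + s := by
  have factor : x ^ 4 - 2 * x ^ 3 - 2 * x ^ 2 - 2 * x + 1 =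
      ((x - (φ - s)) * (x - (φ + s))) * ((x - (1 - φ)) ^ 2 + (φ - 1)) := by
    have left : (x - (φ - s)) * (x - (φ + s)) = x ^ 2 - 2 * φ * x + 1 := by
      linear_combination hφ - hs
    have right : (x - (1 - φ)) ^ 2 + (φ - 1) = x ^ 2 - 2 * (1 - φ) * x + 1 := by
      linear_combination hφ
    rw [left, right]
    linear_combination 4 * x ^ 2 * hφ
  have pos : (x - (1 - φ)) ^ 2 + (φ - 1) ≠ 0 := by
    have := sq_nonneg (x - (1 - φ))
    linarith
  rw [factor, mul_eq_zero, or_iff_left pos, mul_eq_zero, sub_eq_zero, sub_eq_zero]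

theorem real_roots_of_charpoly :
    let φ : ℝ := (1 + Real.sqrt 5) / 2
    {x : ℝ | x ^ 4 - 2 * x ^ 3 - 2 * x ^ 2 - 2 * x + 1 = 0} =
      {φ - Real.sqrt φ, φ + Real.sqrt φ} ∧
    IsGreatest {x : ℝ | x ^ 4 - 2 * x ^ 3 - 2 * x ^ 2 - 2 * x + 1 = 0}
      (φ + Real.sqrt φ) := by
  intro φ
  have hφ : φ ^ 2 = φ + 1 := Real.goldenRatio_sq
  have h1 : 1 < φ := Real.one_lt_goldenRatio
  have hs : Real.sqrt φ ^ 2 = φ := Real.sq_sqrt (by linarith)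
  have roots : {x : ℝ | x ^ 4 - 2 * x ^ 3 - 2 * x ^ 2 - 2 * x + 1 = 0} =
      {φ - Real.sqrt φ, φ + Real.sqrt φ} :=
    Set.ext (quartic_eq_zero_iff hφ hs h1)
  refine ⟨roots, ?_⟩
  rw [roots]
  refine ⟨Or.inr rfl, ?_⟩
  rintro x (rfl | rfl)
  · linarith [Real.sqrt_nonneg φ]
  · exact le_rfl
end

section
/- Let A be the real 4×4 matrix [[0,1,0,0],[0,0,0,1],[0,1,1,1],[1,1,2,1]] and let φ = (1 + √5)/2. Then A has a strictly positive eigenvector with eigenvalue φ + √φ: there exists a vector v : Fin 4 → ℝ with v i > 0 for every i, such that A · v = (φ + √φ) · v. -/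
/-- A root `x > 1` of `x⁴ - 2x³ - 2x² - 2x + 1` is an eigenvalue with a positive eigenvector. -/
theorem exists_pos_eigenvector_of_root {x : ℝ} (hx : 1 < x)
    (hroot : x ^ 4 - 2 * x ^ 3 - 2 * x ^ 2 - 2 * x + 1 = 0) :
    ∃ v : Fin 4 → ℝ, (∀ i, v i > 0) ∧
      (!![0, 1, 0, 0; 0, 0, 0, 1; 0, 1, 1, 1; 1, 1, 2, 1] : Matrix (Fin 4) (Fin 4) ℝ).mulVec v =
        x • v := by
  have hsub : 0 < x - 1 := sub_pos.mpr hx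
  refine ⟨![x - 1, x * (x - 1), x + x ^ 2, x ^ 2 * (x - 1)], fun i ↦ ?_, ?_⟩
  · fin_cases i <;> simp only [Matrix.cons_val, Fin.reduceFinMk, Fin.zero_eta, Fin.mk_one] <;>
      positivity
  · ext i
    fin_cases i <;> simp [Matrix.mulVec, dotProduct, Fin.sum_univ_four]
    · ring
    · ring
    · linear_combination -hroot

theorem goldenRatio_add_sqrt_isRoot {φ : ℝ} (hφ : 0 ≤ φ) (hsq : φ ^ 2 = φ + 1) :
    (φ + √φ) ^ 4 - 2 * (φ + √φ) ^ 3 - 2 * (φ + √φ) ^ 2 - 2 * (φ + √φ) + 1 = 0 := by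
  set x := φ + √φ with hx
  have hquad : x ^ 2 - 2 * φ * x + 1 = 0 := by
    rw [hx]
    linear_combination Real.sq_sqrt hφ - hsq
  linear_combination (x ^ 2 + (2 * φ - 2) * x + 1) * hquad + 4 * x ^ 2 * hsq

theorem positive_eigenvector :
    let A : Matrix (Fin 4) (Fin 4) ℝ :=
      !![0, 1, 0, 0; 0, 0, 0, 1; 0, 1, 1, 1; 1, 1, 2, 1]
    let φ : ℝ := (1 + Real.sqrt 5) / 2
    ∃ v : Fin 4 → ℝ, (∀ i, v i > 0) ∧
      A.mulVec v = (φ + Real.sqrt φ) • v := by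
  intro A φ
  have hφ : 1 < φ := Real.one_lt_goldenRatio
  exact exists_pos_eigenvector_of_root (lt_add_of_lt_of_nonneg hφ (Real.sqrt_nonneg φ))
    (goldenRatio_add_sqrt_isRoot (zero_le_one.trans hφ.le) Real.goldenRatio_sq)
end
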